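/- Let π be a policy with π(a|s) > 0 for all (s,a), let π' be its NPG update with respect to Q̂ and stepsize β, and let π̂ be any policy (in the paper, an optimal policy π*). Then for any probability distribution μ on S, writing d* = d_μ^{π̂}: V^{π̂}(μ) − V^π(μ) = (1/(1−γ)) Σ_s d*(s) Σ_a π̂(a|s) (Q^π(s,a) − Q̂(s,a)) + (1/((1−γ)β)) Σ_s d*(s) log Z(s) + (1/((1−γ)β)) Σ_s d*(s) [KL(π̂(·|s)‖π(·|s)) − KL(π̂(·|s)‖π'(·|s))]. -/

import Mathlib

noncomputable def supNorm {I : Type*} [Fintype I] [Nonempty I] (f : I → ℝ) : ℝ :=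
  Finset.univ.sup' Finset.univ_nonempty (fun i => |f i|)

noncomputable def matNorm {I : Type*} [Fintype I] [Nonempty I] (M : Matrix I I ℝ) : ℝ :=
  supNorm (fun i => ∑ j, |M i j|)

/-- `π` is a policy: for each state `s`, `π s` is a probability distribution on actions. -/
def IsPolicy {S A : Type*} [Fintype A] (π : S → A → ℝ) : Prop :=
  (∀ s a, 0 ≤ π s a) ∧ ∀ s, ∑ a, π s a = 1

/-- A row-stochastic matrix. -/
def IsStochastic {S : Type*} [Fintype S] (P : Matrix S S ℝ) : Prop :=
  (∀ s s', 0 ≤ P s s') ∧ ∀ s, ∑ s', P s s' = 1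

/-- The state-action transition matrix `P_π((s,a),(s',a')) = P_a(s,s') π(a'|s')`. -/
def Psa {S A : Type*} (P : A → Matrix S S ℝ) (π : S → A → ℝ) :
    Matrix (S × A) (S × A) ℝ :=
  Matrix.of fun p q => P p.2 p.1 q.1 * π q.1 q.2

/-- The truncated policy `π_ρ̄(a|s) = min(ρ̄ π_b(a|s), π(a|s)) / Σ_{a'} min(ρ̄ π_b(a'|s), π(a'|s))`. -/
noncomputable def truncPolicy {S A : Type*} [Fintype A] (πb π : S → A → ℝ) (ρ : ℝ) :
    S → A → ℝ :=
  fun s a => min (ρ * πb s a) (π s a) / ∑ a', min (ρ * πb s a') (π s a')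

/-- The diagonal matrix with `D_π((s,a),(s,a)) = Σ_{a'} min(ρ̄ π_b(a'|s), π(a'|s))`. -/
noncomputable def truncDiag {S A : Type*} [Fintype A] [DecidableEq S] [DecidableEq A]
    (πb π : S → A → ℝ) (ρ : ℝ) : Matrix (S × A) (S × A) ℝ :=
  Matrix.diagonal (fun p => ∑ a', min (ρ * πb p.1 a') (π p.1 a'))

/-- The NPG update of policy `π` with respect to `Q̂` and stepsize `β`. -/
noncomputable def npg {S A : Type*} [Fintype A] (π : S → A → ℝ) (β : ℝ)
    (Qh : S × A → ℝ) : S → A → ℝ :=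
  fun s a => π s a * Real.exp (β * Qh (s, a)) / ∑ a', π s a' * Real.exp (β * Qh (s, a'))

/-- The induced state transition matrix `P̃_π(s,s') = Σ_a π(a|s) P_a(s,s')`. -/
noncomputable def PtildeGen {S A : Type*} [Fintype A] (P : A → Matrix S S ℝ)
    (π : S → A → ℝ) : Matrix S S ℝ :=
  Matrix.of fun s s' => ∑ a, π s a * P a s s'

/-- The discounted state visitation distribution
`d_μ^π(s) = (1−γ) Σ_{j=0}^∞ γ^j (μᵀ P̃_π^j)(s)`. -/
noncomputable def dvisit {S A : Type*} [Fintype S] [Fintype A] [DecidableEq S]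
    (P : A → Matrix S S ℝ) (π : S → A → ℝ) (γ : ℝ) (μ : S → ℝ) : S → ℝ :=
  fun s => (1 - γ) * ∑' j : ℕ, γ ^ j * Matrix.vecMul μ (PtildeGen P π ^ j) s

/-- KL divergence `Σ_a p(a) log(p(a)/q(a))` between distributions on actions. -/
noncomputable def klA {A : Type*} [Fintype A] (p q : A → ℝ) : ℝ :=
  ∑ a, p a * Real.log (p a / q a)

/-- The state transition matrix induced by a policy is row-stochastic. -/
theorem isStochastic_PtildeGen {S A : Type*} [Fintype S] [Fintype A]
    {P : A → Matrix S S ℝ} (hP : ∀ a, IsStochastic (P a))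
    {π : S → A → ℝ} (hπ : IsPolicy π) : IsStochastic (PtildeGen P π) := by
  refine ⟨fun s s' => Finset.sum_nonneg fun a _ => mul_nonneg (hπ.1 s a) ((hP a).1 s s'),
    fun s => ?_⟩
  simp only [PtildeGen, Matrix.of_apply]
  rw [Finset.sum_comm]
  simp [← Finset.mul_sum, (hP _).2, hπ.2]

/-- Powers of a stochastic matrix preserve probability vectors. -/
theorem IsStochastic.vecMul_pow {S : Type*} [Fintype S] [DecidableEq S]
    {M : Matrix S S ℝ} (hM : IsStochastic M) {μ : S → ℝ} (hμ0 : ∀ s, 0 ≤ μ s)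
    (hμ1 : ∑ s, μ s = 1) (j : ℕ) :
    (∀ s, 0 ≤ Matrix.vecMul μ (M ^ j) s) ∧ ∑ s, Matrix.vecMul μ (M ^ j) s = 1 := by
  induction j with
  | zero => simpa using ⟨hμ0, hμ1⟩
  | succ j ih =>
    rw [pow_succ, ← Matrix.vecMul_vecMul]
    refine ⟨fun s => Finset.sum_nonneg fun t _ => mul_nonneg (ih.1 t) (hM.1 t s), ?_⟩
    simp only [Matrix.vecMul, dotProduct] at ih ⊢
    rw [Finset.sum_comm]
    simp only [← Finset.mul_sum, hM.2, mul_one]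
    exact ih.2

/-- The discounted occupation series of a stochastic matrix converges. -/
theorem IsStochastic.summable_discounted {S : Type*} [Fintype S] [DecidableEq S]
    {M : Matrix S S ℝ} (hM : IsStochastic M) {μ : S → ℝ} (hμ0 : ∀ s, 0 ≤ μ s)
    (hμ1 : ∑ s, μ s = 1) {γ : ℝ} (hγ0 : 0 ≤ γ) (hγ1 : γ < 1) (s : S) :
    Summable fun j : ℕ => γ ^ j * Matrix.vecMul μ (M ^ j) s := by
  refine Summable.of_nonneg_of_le (fun j => ?_) (fun j => ?_)
    (summable_geometric_of_lt_one hγ0 hγ1)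
  · exact mul_nonneg (pow_nonneg hγ0 j) ((hM.vecMul_pow hμ0 hμ1 j).1 s)
  · obtain ⟨h0, h1⟩ := hM.vecMul_pow hμ0 hμ1 j
    refine mul_le_of_le_one_right (pow_nonneg hγ0 j) ?_
    rw [← h1]
    exact Finset.single_le_sum (fun t _ => h0 t) (Finset.mem_univ s)

/-- The balance equation of the discounted visitation distribution. -/
theorem dvisit_eq {S A : Type*} [Fintype S] [Fintype A] [DecidableEq S]
    {P : A → Matrix S S ℝ} (hP : ∀ a, IsStochastic (P a))
    {π : S → A → ℝ} (hπ : IsPolicy π) {μ : S → ℝ} (hμ0 : ∀ s, 0 ≤ μ s)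
    (hμ1 : ∑ s, μ s = 1) {γ : ℝ} (hγ0 : 0 ≤ γ) (hγ1 : γ < 1) (s : S) :
    dvisit P π γ μ s =
      (1 - γ) * μ s + γ * ∑ t, dvisit P π γ μ t * PtildeGen P π t s := by
  have hsum := (isStochastic_PtildeGen hP hπ).summable_discounted hμ0 hμ1 hγ0 hγ1
  have hstep : ∀ j : ℕ, γ ^ (j + 1) * Matrix.vecMul μ (PtildeGen P π ^ (j + 1)) s =
      ∑ t, γ * (γ ^ j * Matrix.vecMul μ (PtildeGen P π ^ j) t * PtildeGen P π t s) := by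
    intro j
    rw [pow_succ (PtildeGen P π), ← Matrix.vecMul_vecMul]
    simp only [Matrix.vecMul, dotProduct, Finset.mul_sum (a := γ ^ (j + 1))]
    exact Finset.sum_congr rfl fun t _ => by ring
  simp only [dvisit]
  rw [(hsum s).tsum_eq_zero_add]
  simp only [hstep]
  rw [Summable.tsum_finsetSum fun t _ => ((hsum t).mul_right _).mul_left _]
  simp only [tsum_mul_left, tsum_mul_right, pow_zero, Matrix.vecMul_one, one_mul, mul_add,
    Finset.mul_sum]
  congr 1
  exact Finset.sum_congr rfl fun t _ => by ring

/-- If `W = g + γ P̃ W`, then the `μ`-average of `W` is the normalized average of `g` under the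
discounted visitation distribution. -/
theorem sum_mul_dvisit {S A : Type*} [Fintype S] [Fintype A] [DecidableEq S]
    {P : A → Matrix S S ℝ} (hP : ∀ a, IsStochastic (P a))
    {π : S → A → ℝ} (hπ : IsPolicy π) {μ : S → ℝ} (hμ0 : ∀ s, 0 ≤ μ s)
    (hμ1 : ∑ s, μ s = 1) {γ : ℝ} (hγ0 : 0 ≤ γ) (hγ1 : γ < 1) {W g : S → ℝ}
    (hW : ∀ s, W s = g s + γ * ∑ t, PtildeGen P π s t * W t) :
    ∑ s, dvisit P π γ μ s * g s = (1 - γ) * ∑ s, μ s * W s := by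
  set d := dvisit P π γ μ
  have h1 : ∑ s, d s * W s =
      ∑ s, d s * g s + γ * ∑ s, ∑ t, d s * PtildeGen P π s t * W t := by
    rw [Finset.mul_sum, ← Finset.sum_add_distrib]
    refine Finset.sum_congr rfl fun s _ => ?_
    rw [hW s, mul_add, mul_left_comm, Finset.mul_sum]
    simp only [mul_assoc]
  have h2 : ∑ s, d s * W s =
      (1 - γ) * ∑ s, μ s * W s + γ * ∑ s, ∑ t, d s * PtildeGen P π s t * W t := by
    rw [Finset.sum_comm, Finset.mul_sum, Finset.mul_sum, ← Finset.sum_add_distrib]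
    refine Finset.sum_congr rfl fun s _ => ?_
    rw [← Finset.sum_mul, show d s = _ from dvisit_eq hP hπ hμ0 hμ1 hγ0 hγ1 s]
    ring
  linarith

/-- The Bellman equation in terms of the state values. -/
theorem bellman_apply {S A : Type*} [Fintype S] [Fintype A] {P : A → Matrix S S ℝ}
    {R : S × A → ℝ} {γ : ℝ} {π : S → A → ℝ} {Q : S × A → ℝ}
    (hQ : Q = R + γ • (Psa P π).mulVec Q) (s : S) (a : A) :
    Q (s, a) = R (s, a) + γ * ∑ t, P a s t * ∑ b, π t b * Q (t, b) := by
  conv_lhs => rw [hQ]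
  simp [Matrix.mulVec, dotProduct, Psa, Fintype.sum_prod_type, Finset.mul_sum, mul_assoc]

/-- The performance difference lemma. -/
theorem performance_difference {S A : Type*} [Fintype S] [Fintype A] [DecidableEq S]
    {P : A → Matrix S S ℝ} (hP : ∀ a, IsStochastic (P a)) {R : S × A → ℝ}
    {γ : ℝ} (hγ0 : 0 ≤ γ) (hγ1 : γ < 1) {π πhat : S → A → ℝ} (hπhat : IsPolicy πhat)
    {Qpi Qhat : S × A → ℝ} (hQpi : Qpi = R + γ • (Psa P π).mulVec Qpi)
    (hQhat : Qhat = R + γ • (Psa P πhat).mulVec Qhat)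
    {μ : S → ℝ} (hμ0 : ∀ s, 0 ≤ μ s) (hμ1 : ∑ s, μ s = 1) :
    (1 - γ) * ((∑ s, μ s * ∑ a, πhat s a * Qhat (s, a))
        - ∑ s, μ s * ∑ a, π s a * Qpi (s, a)) =
      ∑ s, dvisit P πhat γ μ s *
        ∑ a, πhat s a * (Qpi (s, a) - ∑ b, π s b * Qpi (s, b)) := by
  rw [← Finset.sum_sub_distrib]
  simp only [← mul_sub]
  refine (sum_mul_dvisit hP hπhat hμ0 hμ1 hγ0 hγ1 fun s => ?_).symm
  have key : ∀ a, πhat s a * Qhat (s, a) = πhat s a * Qpi (s, a) +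
      γ * ∑ t, πhat s a * P a s t *
        (∑ b, πhat t b * Qhat (t, b) - ∑ b, π t b * Qpi (t, b)) := by
    intro a
    rw [bellman_apply hQhat s a, bellman_apply hQpi s a]
    simp only [mul_sub, Finset.sum_sub_distrib, mul_assoc, ← Finset.mul_sum]
    ring
  simp only [PtildeGen, Matrix.of_apply, Finset.sum_mul]
  rw [Finset.sum_congr rfl fun a _ => key a, Finset.sum_add_distrib, ← Finset.mul_sum,
    Finset.sum_comm]
  simp only [mul_sub, Finset.sum_sub_distrib, ← Finset.sum_mul, hπhat.2]
  ring

/-- The KL difference produced by an NPG update. -/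
theorem klA_sub_klA_npg {S A : Type*} [Fintype A] [Nonempty A] {π : S → A → ℝ} {s : S}
    (hπpos : ∀ a, 0 < π s a) (β : ℝ) (Qh : S × A → ℝ) {p : A → ℝ} (hp : ∑ a, p a = 1) :
    klA p (π s) - klA p (npg π β Qh s) =
      β * ∑ a, p a * Qh (s, a) - Real.log (∑ a, π s a * Real.exp (β * Qh (s, a))) := by
  set Y := ∑ a, π s a * Real.exp (β * Qh (s, a)) with hY
  have hYpos : 0 < Y :=
    Finset.sum_pos (fun a _ => mul_pos (hπpos a) (Real.exp_pos _)) Finset.univ_nonempty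
  have hterm : ∀ a, p a * Real.log (p a / π s a) - p a * Real.log (p a / npg π β Qh s a) =
      β * (p a * Qh (s, a)) - p a * Real.log Y := by
    intro a
    by_cases hpa : p a = 0
    · simp [hpa]
    have hπa := (hπpos a).ne'
    have he := (Real.exp_pos (β * Qh (s, a))).ne'
    rw [npg, ← hY, Real.log_div hpa hπa, Real.log_div hpa (by positivity),
      Real.log_div (mul_ne_zero hπa he) hYpos.ne', Real.log_mul hπa he, Real.log_exp]
    ring
  rw [klA, klA, ← Finset.sum_sub_distrib, Finset.sum_congr rfl fun a _ => hterm a,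
    Finset.sum_sub_distrib, ← Finset.mul_sum, ← Finset.sum_mul, hp, one_mul]

/-- Shifting the exponent by a constant shifts the log-partition function. -/
theorem log_sum_mul_exp_sub {A : Type*} [Fintype A] [Nonempty A] {p : A → ℝ}
    (hp : ∀ a, 0 < p a) (β c : ℝ) (q : A → ℝ) :
    Real.log (∑ a, p a * Real.exp (β * (q a - c))) =
      Real.log (∑ a, p a * Real.exp (β * q a)) - β * c := by
  have hpos : 0 < ∑ a, p a * Real.exp (β * q a) :=
    Finset.sum_pos (fun a _ => mul_pos (hp a) (Real.exp_pos _)) Finset.univ_nonempty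
  simp only [mul_sub, Real.exp_sub, mul_div_assoc', ← Finset.sum_div]
  rw [Real.log_div hpos.ne' (Real.exp_pos _).ne', Real.log_exp]

/-- For the NPG update `π'` of `π` with respect to `Q̂` and stepsize `β`,
any policy `π̂`, and any initial distribution `μ`, writing `d* = d_μ^{π̂}`:
`V^{π̂}(μ) − V^π(μ) = (1/(1−γ)) Σ_s d*(s) Σ_a π̂(a|s)(Q^π(s,a) − Q̂(s,a))
  + (1/((1−γ)β)) Σ_s d*(s) log Z(s)
  + (1/((1−γ)β)) Σ_s d*(s) [KL(π̂(·|s)‖π(·|s)) − KL(π̂(·|s)‖π'(·|s))]`. -/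
theorem npg_performance_difference_identity
    {S A : Type*} [Fintype S] [Fintype A] [Nonempty S] [Nonempty A] [DecidableEq S]
    (P : A → Matrix S S ℝ) (hP : ∀ a, IsStochastic (P a))
    (R : S × A → ℝ) (hR : ∀ x, 0 ≤ R x ∧ R x ≤ 1)
    (γ : ℝ) (hγ0 : 0 < γ) (hγ1 : γ < 1)
    (π : S → A → ℝ) (hπ : IsPolicy π) (hπpos : ∀ s a, 0 < π s a)
    (β : ℝ) (hβ : 0 < β) (Qh : S × A → ℝ)
    (Qpi : S × A → ℝ) (hQpi : Qpi = R + γ • (Psa P π).mulVec Qpi)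
    (πhat : S → A → ℝ) (hπhat : IsPolicy πhat)
    (Qhat : S × A → ℝ) (hQhat : Qhat = R + γ • (Psa P πhat).mulVec Qhat)
    (μ : S → ℝ) (hμ0 : ∀ s, 0 ≤ μ s) (hμ1 : ∑ s, μ s = 1) :
    (∑ s, μ s * (∑ a, πhat s a * Qhat (s, a)))
        - (∑ s, μ s * (∑ a, π s a * Qpi (s, a))) =
      (1 / (1 - γ)) * (∑ s, dvisit P πhat γ μ s *
          (∑ a, πhat s a * (Qpi (s, a) - Qh (s, a))))
        + (1 / ((1 - γ) * β)) * (∑ s, dvisit P πhat γ μ s *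
            Real.log (∑ a, π s a *
              Real.exp (β * (Qh (s, a) - ∑ a', π s a' * Qpi (s, a')))))
        + (1 / ((1 - γ) * β)) * (∑ s, dvisit P πhat γ μ s *
            (klA (πhat s) (π s) - klA (πhat s) (npg π β Qh s))) := by
  have hγ : 1 - γ ≠ 0 := by linarith
  have hβ' : β ≠ 0 := hβ.ne'
  rw [← mul_right_inj' hγ, performance_difference hP hγ0.le hγ1 hπhat hQpi hQhat hμ0 hμ1]
  simp only [log_sum_mul_exp_sub (hπpos _) β _ fun a => Qh (_, a),
    klA_sub_klA_npg (hπpos _) β Qh (hπhat.2 _)]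
  simp only [Finset.mul_sum (s := (Finset.univ : Finset S)), ← Finset.sum_add_distrib]
  refine Finset.sum_congr rfl fun s _ => ?_
  simp only [mul_sub (πhat s _), Finset.sum_sub_distrib, ← Finset.sum_mul, hπhat.2]
  field_simp
  ring
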